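/- For every integer k ≥ 1, setting d_i := 2^i + 2i + 5k − 4, one has lim_{i→∞} (log₂ K(d_i, k))/d_i = 1. That is, the limit ν(k) equals 1 along the subsequence of dimensions d_i → ∞. -/

import Mathlib

/-- Cyclic distance between two indices on a cycle of length `N`. -/
def cycDist {N : ℕ} (i j : ZMod N) : ℕ := min (j - i).val (i - j).val

/-- A `(d,k)` circuit code of length `N`: a simple cycle `x₁,…,x_N` in the
`d`-dimensional hypercube graph `I(d)` (vertices are binary vectors of length
`d`, adjacency is Hamming distance `1`, and the graph distance in `I(d)` equals
the Hamming distance) such that for any two vertices of the cycle the graph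
distance is at least the minimum of their distance along the cycle and `k`. -/
def IsCircuitCode (d k N : ℕ) (x : ZMod N → (Fin d → Bool)) : Prop :=
  3 ≤ N ∧ Function.Injective x ∧
    (∀ i : ZMod N, hammingDist (x i) (x (i + 1)) = 1) ∧
    (∀ i j : ZMod N, min (cycDist i j) k ≤ hammingDist (x i) (x j))

/-- `K d k`: the maximum length of a `(d,k)` circuit code. -/
noncomputable def K (d k : ℕ) : ℕ :=
  sSup {N | ∃ x : ZMod N → (Fin d → Bool), IsCircuitCode d k N x}

open Finset

theorem hammingDist_eq_sum_ite {ι : Type*} [Fintype ι] (x y : ι → Bool) :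
    hammingDist x y = ∑ a, if x a ≠ y a then 1 else 0 := by
  rw [hammingDist, card_filter]

/-- Hermite's identity over the naturals. -/
theorem sum_range_add_div (L : ℕ) (hL : 0 < L) (t : ℕ) :
    ∑ j ∈ range L, (t + j) / L = t := by
  induction t with
  | zero =>
    refine sum_eq_zero fun j hj => ?_
    rw [zero_add]
    exact Nat.div_eq_of_lt (mem_range.1 hj)
  | succ t ih =>
    have h := sum_range_succ (fun j => (t + j) / L) L
    rw [sum_range_succ', ih, Nat.add_div_right _ hL] at h
    have h' : ∑ j ∈ range L, (t + 1 + j) / L = ∑ j ∈ range L, (t + (j + 1)) / L :=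
      sum_congr rfl fun j _ => by rw [add_assoc, add_comm 1 j]
    simp only [add_zero] at h
    omega

/-! ### Cyclic Gray codes -/

/-- A listing of all binary words of length `n` in which cyclically consecutive words are
adjacent in the hypercube, extended periodically. -/
structure IsCyclicGrayCode (n : ℕ) (g : ℕ → Fin n → Bool) : Prop where
  mod_eq_of_eq : ∀ a b, g a = g b → a % 2 ^ n = b % 2 ^ n
  periodic : Function.Periodic g (2 ^ n)
  hammingDist_succ : ∀ a, hammingDist (g a) (g (a + 1)) = 1

theorem hammingDist_cons {n : ℕ} (b c : Bool) (x y : Fin n → Bool) :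
    hammingDist (Fin.cons b x : Fin (n + 1) → Bool) (Fin.cons c y) =
      (if b ≠ c then 1 else 0) + hammingDist x y := by
  simp only [hammingDist_eq_sum_ite, Fin.sum_univ_succ, Fin.cons_zero, Fin.cons_succ]

/-- The reflected Gray code, as a Hamiltonian path of the hypercube. -/
theorem exists_gray_path (n : ℕ) : ∃ g : ℕ → Fin n → Bool,
    (∀ a < 2 ^ n, ∀ b < 2 ^ n, g a = g b → a = b) ∧
    (∀ a, a + 1 < 2 ^ n → hammingDist (g a) (g (a + 1)) = 1) ∧
    (1 ≤ n → hammingDist (g (2 ^ n - 1)) (g 0) = 1) := by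
  induction n with
  | zero => exact ⟨fun _ _ => false, by simp, by simp, by simp⟩
  | succ n ih =>
    obtain ⟨g, hinj, hstep, -⟩ := ih
    have hP : 0 < 2 ^ n := by positivity
    have hP2 : 2 ^ (n + 1) = 2 * 2 ^ n := by ring
    rw [hP2]
    generalize 2 ^ n = P at *
    refine ⟨fun t => if t < P then Fin.cons false (g t)
      else Fin.cons true (g (2 * P - 1 - t)), ?_, ?_, ?_⟩
    · intro a ha b hb h
      simp only at h
      split_ifs at h with h1 h2 h2
      · exact hinj a h1 b h2 (Fin.cons_injective2 h).2
      · exact absurd (Fin.cons_injective2 h).1 (by simp)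
      · exact absurd (Fin.cons_injective2 h).1 (by simp)
      · have := hinj _ (by omega) _ (by omega) (Fin.cons_injective2 h).2
        omega
    · intro a ha
      simp only
      split_ifs with h1 h2 h2
      · rw [hammingDist_cons, hstep a h2]; simp
      · rw [hammingDist_cons, show 2 * P - 1 - (a + 1) = a by omega]; simp
      · omega
      · have h := hstep (2 * P - 1 - (a + 1)) (by omega)
        rw [show 2 * P - 1 - (a + 1) + 1 = 2 * P - 1 - a by omega] at h
        rw [hammingDist_cons, hammingDist_comm, h]; simp
    · intro _
      simp only
      rw [if_neg (by omega), if_pos hP, hammingDist_cons]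
      simp

theorem exists_isCyclicGrayCode (n : ℕ) (hn : 1 ≤ n) : ∃ g, IsCyclicGrayCode n g := by
  obtain ⟨g, hinj, hstep, hwrap⟩ := exists_gray_path n
  have hP : 0 < 2 ^ n := by positivity
  have hP1 : 1 < 2 ^ n := Nat.one_lt_two_pow (by omega)
  refine ⟨fun t => g (t % 2 ^ n), ?_, ?_, ?_⟩
  · intro a b h
    exact hinj _ (Nat.mod_lt _ hP) _ (Nat.mod_lt _ hP) h
  · intro a
    simp
  · intro a
    have ha := Nat.mod_lt a hP
    simp only [Nat.add_mod a 1, Nat.mod_eq_of_lt hP1]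
    by_cases h : a % 2 ^ n + 1 < 2 ^ n
    · rw [Nat.mod_eq_of_lt h]
      exact hstep _ h
    · have h' : a % 2 ^ n + 1 = 2 ^ n := by omega
      rw [h', Nat.mod_self, show a % 2 ^ n = 2 ^ n - 1 by omega]
      exact hwrap hn

namespace IsCyclicGrayCode

variable {n : ℕ} {g : ℕ → Fin n → Bool}

theorem ne_of_lt (hg : IsCyclicGrayCode n g) {a b : ℕ} (h1 : a < b) (h2 : b < a + 2 ^ n) :
    g a ≠ g b := by
  intro h
  have h3 : a ≡ b [MOD 2 ^ n] := hg.mod_eq_of_eq a b h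
  have h4 := (Nat.modEq_iff_dvd' h1.le).1 h3
  have := Nat.le_of_dvd (by omega) h4
  omega

theorem hammingDist_eq_sub (hg : IsCyclicGrayCode n g) {a b : ℕ} (h1 : a ≤ b) (h2 : b ≤ a + 1) :
    hammingDist (g a) (g b) = b - a := by
  obtain rfl | rfl : b = a ∨ b = a + 1 := by omega
  · simp
  · rw [hg.hammingDist_succ]; omega

end IsCyclicGrayCode

/-! ### Colourings separating words at small Hamming distance -/

/-- A Reed–Solomon type syndrome: `D * t` bits suffice to tell apart any two distinct words of
length at most `2 ^ t` at Hamming distance at most `D`. -/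
theorem exists_separating_map (n t D : ℕ) (ht : t ≠ 0) (hn : n ≤ 2 ^ t) :
    ∃ p : (Fin n → Bool) → (Fin (D * t) → Bool),
      ∀ u v, u ≠ v → hammingDist u v ≤ D → p u ≠ p v := by
  classical
  have hcF : Nat.card (GaloisField 2 t) = 2 ^ t := GaloisField.card 2 t ht
  have : Finite (GaloisField 2 t) := Nat.finite_of_card_ne_zero (by rw [hcF]; positivity)
  have : Fintype (GaloisField 2 t) := Fintype.ofFinite _
  rw [Nat.card_eq_fintype_card] at hcF
  obtain ⟨f⟩ : Nonempty (Fin n ↪ GaloisField 2 t) :=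
    Function.Embedding.nonempty_of_card_le (by simpa [hcF] using hn)
  obtain ⟨e⟩ : Nonempty ((Fin D → GaloisField 2 t) ↪ (Fin (D * t) → Bool)) :=
    Function.Embedding.nonempty_of_card_le (by simp [hcF, ← pow_mul, mul_comm])
  let ind (u : Fin n → Bool) (a : Fin n) : GaloisField 2 t := if u a then 1 else 0
  refine ⟨fun u => e fun i => ∑ a, ind u a * f a ^ (i : ℕ), fun u v huv hd h => ?_⟩
  have hpow (i : ℕ) (hi : i < D) : ∑ a, (ind u a - ind v a) * f a ^ i = 0 := by
    have := congrFun (e.injective h) ⟨i, hi⟩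
    simp only at this
    simp only [sub_mul, sum_sub_distrib, this, sub_self]
  obtain ⟨a₀, ha₀⟩ := Function.ne_iff.1 huv
  have ha₀' : a₀ ∈ ({a | u a ≠ v a} : Finset (Fin n)) := by simpa using ha₀
  let q : Polynomial (GaloisField 2 t) :=
    ∏ b ∈ ({a | u a ≠ v a} : Finset (Fin n)).erase a₀, (Polynomial.X - Polynomial.C (f b))
  have hdeg : q.natDegree < D := by
    have h1 : q.natDegree = #(({a | u a ≠ v a} : Finset (Fin n)).erase a₀) :=
      Polynomial.natDegree_finsetProd_X_sub_C_eq_card _ _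
    rw [h1]
    exact (card_erase_lt_of_mem ha₀').trans_le hd
  have hq : ∑ a, (ind u a - ind v a) * q.eval (f a) = 0 := by
    simp only [Polynomial.eval_eq_sum_range' hdeg, mul_sum]
    rw [sum_comm]
    refine sum_eq_zero fun i hi => ?_
    rw [← mul_zero (q.coeff i), ← hpow i (mem_range.1 hi), mul_sum]
    exact sum_congr rfl fun a _ => by ring
  rw [sum_eq_single a₀] at hq
  · rcases mul_eq_zero.1 hq with h1 | h1
    · have h2 : ind u a₀ = ind v a₀ := sub_eq_zero.1 h1
      simp only [ind] at h2
      generalize u a₀ = x at *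
      generalize v a₀ = y at *
      cases x <;> cases y <;> simp_all
    · rw [Polynomial.eval_prod, prod_eq_zero_iff] at h1
      obtain ⟨b, hb, hb'⟩ := h1
      simp only [Polynomial.eval_sub, Polynomial.eval_X, Polynomial.eval_C, sub_eq_zero] at hb'
      exact (mem_erase.1 hb).1 (f.injective hb').symm
  · intro a _ ha
    by_cases hau : u a = v a
    · simp [ind, hau]
    · have : q.eval (f a) = 0 := by
        rw [Polynomial.eval_prod]
        refine prod_eq_zero (i := a) ?_ (by simp)
        simpa [ha] using hau
      rw [this, mul_zero]
  · intro h1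
    exact absurd (mem_univ _) h1

/-! ### The construction -/

/-- The walk underlying the construction: a Gray code word together with `M` copies of its
`p`-image, all components being updated in turn, one bit at a time. The last family of
coordinates makes every update of a component flip exactly one bit. -/
def syndromeWalk {n s : ℕ} (M : ℕ) (g : ℕ → Fin n → Bool) (p : (Fin n → Bool) → Fin s → Bool)
    (t : ℕ) : Fin n ⊕ (Fin M × Fin s) ⊕ (Fin M × Fin s) → Bool
  | .inl a => g ((t + M * s) / (M * s + 1)) a
  | .inr (.inl j) => p (g ((t + (j.2 + s * j.1)) / (M * s + 1))) j.2
  | .inr (.inr j) => (p (g ((t + (j.2 + s * j.1)) / (M * s + 1))) j.2).xor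
      ((t + (j.2 + s * j.1)) / (M * s + 1)).bodd

theorem hammingDist_syndromeWalk {n s : ℕ} (M : ℕ) (g : ℕ → Fin n → Bool)
    (p : (Fin n → Bool) → Fin s → Bool) (t t' : ℕ) :
    hammingDist (syndromeWalk M g p t) (syndromeWalk M g p t') =
      hammingDist (g ((t + M * s) / (M * s + 1))) (g ((t' + M * s) / (M * s + 1))) +
      ∑ j : Fin M × Fin s,
        ((if syndromeWalk M g p t (.inr (.inl j)) ≠ syndromeWalk M g p t' (.inr (.inl j))
          then 1 else 0) +
         (if syndromeWalk M g p t (.inr (.inr j)) ≠ syndromeWalk M g p t' (.inr (.inr j))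
          then 1 else 0)) := by
  rw [hammingDist_eq_sum_ite, Fintype.sum_sum_type, Fintype.sum_sum_type, sum_add_distrib,
    hammingDist_eq_sum_ite]
  rfl

theorem sum_prod_fin_eq_sum_range (M s : ℕ) (f : ℕ → ℕ) :
    ∑ j : Fin M × Fin s, f (j.2 + s * j.1) = ∑ j ∈ range (M * s), f j := by
  rw [sum_range, ← finProdFinEquiv.sum_comp]
  rfl

theorem syndromeWalk_periodic {n s : ℕ} (M : ℕ) {g : ℕ → Fin n → Bool} (hn : 1 ≤ n)
    (hg : IsCyclicGrayCode n g) (p : (Fin n → Bool) → Fin s → Bool) :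
    Function.Periodic (syndromeWalk M g p) (2 ^ n * (M * s + 1)) := by
  have hdiv (t j : ℕ) : (t + 2 ^ n * (M * s + 1) + j) / (M * s + 1)
      = (t + j) / (M * s + 1) + 2 ^ n := by
    rw [add_right_comm, Nat.add_mul_div_right _ _ (by positivity)]
  have hodd : (2 ^ n).bodd = false := by
    obtain ⟨m, rfl⟩ : ∃ m, n = m + 1 := ⟨n - 1, by omega⟩
    rw [pow_succ, Nat.bodd_mul]; simp
  intro t
  ext (a | j | j)
  · simp only [syndromeWalk, hdiv, hg.periodic _]
  · simp only [syndromeWalk, hdiv, hg.periodic _]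
  · simp only [syndromeWalk, hdiv, hg.periodic _, Nat.bodd_add, hodd, Bool.xor_false]

theorem ite_ne_add_ite_xor_bodd_ne (f : ℕ → Bool) {a b : ℕ} (h1 : a ≤ b) (h2 : b ≤ a + 1) :
    ((if f a ≠ f b then 1 else 0) +
      (if (f a).xor a.bodd ≠ (f b).xor b.bodd then 1 else 0)) = b - a := by
  obtain rfl | rfl : b = a ∨ b = a + 1 := by omega
  · simp
  · rw [Nat.bodd_succ]
    cases f a <;> cases f (a + 1) <;> cases a.bodd <;> simp

/-- During one full round of updates the walk is a geodesic. -/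
theorem hammingDist_syndromeWalk_of_le {n s : ℕ} (M : ℕ) {g : ℕ → Fin n → Bool}
    (hg : IsCyclicGrayCode n g) (p : (Fin n → Bool) → Fin s → Bool) (t δ : ℕ)
    (hδ : δ ≤ M * s + 1) :
    hammingDist (syndromeWalk M g p t) (syndromeWalk M g p (t + δ)) = δ := by
  have h1 (j : ℕ) : (t + j) / (M * s + 1) ≤ (t + δ + j) / (M * s + 1) :=
    Nat.div_le_div_right (by omega)
  have h2 (j : ℕ) : (t + δ + j) / (M * s + 1) ≤ (t + j) / (M * s + 1) + 1 := by
    rw [← Nat.add_div_right _ (by positivity)]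
    exact Nat.div_le_div_right (by omega)
  rw [hammingDist_syndromeWalk, hg.hammingDist_eq_sub (h1 _) (h2 _)]
  have key (j : Fin M × Fin s) :
      ((if syndromeWalk M g p t (.inr (.inl j)) ≠ syndromeWalk M g p (t + δ) (.inr (.inl j))
          then 1 else 0) +
         (if syndromeWalk M g p t (.inr (.inr j)) ≠ syndromeWalk M g p (t + δ) (.inr (.inr j))
          then 1 else 0)) = (fun i => (t + δ + i) / (M * s + 1) - (t + i) / (M * s + 1))
            (j.2 + s * j.1) := by
    exact ite_ne_add_ite_xor_bodd_ne (fun a => p (g a) j.2) (h1 _) (h2 _)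
  rw [sum_congr rfl fun j _ => key j, sum_prod_fin_eq_sum_range M s
      (fun i => (t + δ + i) / (M * s + 1) - (t + i) / (M * s + 1)), add_comm,
    ← sum_range_succ (fun i => (t + δ + i) / (M * s + 1) - (t + i) / (M * s + 1)),
    sum_tsub_distrib _ fun i _ => h1 i, sum_range_add_div _ (by positivity),
    sum_range_add_div _ (by positivity), Nat.add_sub_cancel_left]

/-- At any time at most one of the `M` copies is being updated. -/
theorem exists_block_div_eq (M s t : ℕ) : ∃ c₀, ∀ c < M, c ≠ c₀ → ∀ i < s,
    (t + (i + s * c)) / (M * s + 1) = (t + s * c) / (M * s + 1) := by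
  have hr := Nat.mod_lt t (show 0 < M * s + 1 by positivity)
  have ht := Nat.div_add_mod t (M * s + 1)
  generalize hL : M * s + 1 = L at *
  refine ⟨(L - t % L) / s, fun c hc hne i hi => ?_⟩
  have hcs : s * (c + 1) ≤ M * s := by rw [mul_comm M]; exact Nat.mul_le_mul_left _ hc
  rw [mul_add, mul_one] at hcs
  have hs : 0 < s := by omega
  have hdiv (j : ℕ) : (t + j) / L = t / L + (t % L + j) / L := by
    conv_lhs => rw [← ht, add_assoc, add_comm, Nat.add_mul_div_left _ _ (by omega), add_comm]
  rw [hdiv, hdiv (s * c)]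
  congr 1
  rcases lt_or_gt_of_ne hne with h | h
  · have h1 : s * (c + 1) ≤ L - t % L :=
      (Nat.mul_le_mul_left _ h).trans (Nat.mul_div_le _ _)
    rw [mul_add, mul_one] at h1
    rw [Nat.div_eq_of_lt (by omega), Nat.div_eq_of_lt (by omega)]
  · have h1 : L - t % L < c * s := (Nat.div_lt_iff_lt_mul hs).1 h
    rw [mul_comm] at h1
    rw [Nat.div_eq_of_lt_le (k := 1) (by omega) (by omega),
      Nat.div_eq_of_lt_le (k := 1) (by omega) (by omega)]

/-- Points of the walk that are more than one round apart are far apart in the hypercube. -/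
theorem le_hammingDist_syndromeWalk {n s k : ℕ} (hn : 1 ≤ n) {g : ℕ → Fin n → Bool}
    (hg : IsCyclicGrayCode n g) {p : (Fin n → Bool) → Fin s → Bool}
    (hp : ∀ u v, u ≠ v → hammingDist u v ≤ k + 1 → p u ≠ p v) (t δ : ℕ)
    (hδ : (k + 2) * s + 1 ≤ δ) (hδ' : 2 * δ ≤ 2 ^ n * ((k + 2) * s + 1)) :
    k ≤ hammingDist (syndromeWalk (k + 2) g p t) (syndromeWalk (k + 2) g p (t + δ)) := by
  rw [hammingDist_syndromeWalk]
  obtain ⟨c₁, hc₁⟩ := exists_block_div_eq (k + 2) s t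
  obtain ⟨c₂, hc₂⟩ := exists_block_div_eq (k + 2) s (t + δ)
  generalize hL : (k + 2) * s + 1 = L at *
  have hL0 : 0 < L := by omega
  have hP : 2 ≤ 2 ^ n := Nat.le_self_pow (by omega) 2
  have hlt (j : ℕ) : (t + j) / L < (t + δ + j) / L := by
    rw [Nat.lt_iff_add_one_le, ← Nat.add_div_right _ hL0]
    exact Nat.div_le_div_right (by omega)
  have hlt' (j : ℕ) : (t + δ + j) / L < (t + j) / L + 2 ^ n := by
    have h1 : (t + δ + j) / L ≤ (t + j + (2 ^ n - 1) * L) / L := by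
      refine Nat.div_le_div_right ?_
      have h2 : 2 ^ n * L ≤ 2 * ((2 ^ n - 1) * L) := by
        rw [← mul_assoc]
        exact Nat.mul_le_mul_right _ (by omega)
      omega
    rw [Nat.add_mul_div_right _ _ hL0] at h1
    omega
  have hstep (t' j : ℕ) (hj : j ≤ (k + 2) * s) :
      hammingDist (g ((t' + j) / L)) (g ((t' + (k + 2) * s) / L)) ≤ 1 := by
    have h1 : (t' + j) / L ≤ (t' + (k + 2) * s) / L := Nat.div_le_div_right (by omega)
    have h2 : (t' + (k + 2) * s) / L ≤ (t' + j) / L + 1 := by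
      rw [← Nat.add_div_right _ hL0]
      exact Nat.div_le_div_right (by omega)
    rw [hg.hammingDist_eq_sub h1 h2]
    omega
  by_cases hk : k ≤ hammingDist (g ((t + (k + 2) * s) / L)) (g ((t + δ + (k + 2) * s) / L))
  · exact hk.trans (Nat.le_add_right _ _)
  refine le_trans ?_ (Nat.le_add_left _ _)
  have hne (j : ℕ) (hj : j ≤ (k + 2) * s) : p (g ((t + j) / L)) ≠ p (g ((t + δ + j) / L)) := by
    refine hp _ _ (hg.ne_of_lt (hlt j) (hlt' j)) ?_
    have h1 := hstep t j hj
    have h2 := hstep (t + δ) j hj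
    have h3 := hammingDist_triangle (g ((t + j) / L)) (g ((t + (k + 2) * s) / L))
      (g ((t + δ + j) / L))
    have h4 := hammingDist_triangle (g ((t + (k + 2) * s) / L)) (g ((t + δ + (k + 2) * s) / L))
      (g ((t + δ + j) / L))
    rw [hammingDist_comm (g ((t + δ + (k + 2) * s) / L))] at h4
    omega
  have hblock (c : Fin (k + 2)) (h1 : (c : ℕ) ≠ c₁) (h2 : (c : ℕ) ≠ c₂) :
      1 ≤ ∑ i : Fin s, if syndromeWalk (k + 2) g p t (.inr (.inl (c, i))) ≠
        syndromeWalk (k + 2) g p (t + δ) (.inr (.inl (c, i))) then 1 else 0 := by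
    have hcs : s * c ≤ (k + 2) * s := by
      rw [mul_comm]
      exact Nat.mul_le_mul_right _ c.2.le
    obtain ⟨i, hi⟩ := Function.ne_iff.1 (hne (s * c) hcs)
    refine le_trans ?_ (single_le_sum (fun _ _ => Nat.zero_le _) (mem_univ i))
    rw [if_pos]
    simpa only [syndromeWalk, hL, hc₁ c c.2 h1 i i.2, hc₂ c c.2 h2 i i.2] using hi
  have hcard : k ≤ #{c : Fin (k + 2) | (c : ℕ) ≠ c₁ ∧ (c : ℕ) ≠ c₂} := by
    have h1 : #{c : Fin (k + 2) | ¬((c : ℕ) ≠ c₁ ∧ (c : ℕ) ≠ c₂)} ≤ 2 := by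
      refine le_trans ?_ (card_le_two (a := c₁) (b := c₂))
      refine card_le_card_of_injOn (fun c => (c : ℕ)) ?_ (Fin.val_injective.injOn)
      intro c hc
      simp only [coe_filter, Set.mem_ofPred_eq, mem_univ, true_and] at hc
      simp only [coe_insert, coe_singleton, Set.mem_insert_iff, Set.mem_singleton_iff]
      tauto
    have h2 := card_filter_add_card_filter_not (s := (univ : Finset (Fin (k + 2))))
      (fun c => (c : ℕ) ≠ c₁ ∧ (c : ℕ) ≠ c₂)
    rw [card_univ, Fintype.card_fin] at h2
    omega
  rw [sum_add_distrib, Fintype.sum_prod_type]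
  refine le_trans ?_ (Nat.le_add_right _ _)
  refine hcard.trans ?_
  rw [card_filter]
  refine sum_le_sum fun c _ => ?_
  split_ifs with h
  · exact hblock c h.1 h.2
  · exact Nat.zero_le _

/-! ### From periodic walks to circuit codes -/

theorem hammingDist_extend {ι κ : Type*} [Fintype ι] [Fintype κ] {e : ι → κ}
    (he : Function.Injective e) (x y : ι → Bool) (z : κ → Bool) :
    hammingDist (Function.extend e x z) (Function.extend e y z) = hammingDist x y := by
  classical
  rw [hammingDist, hammingDist]
  symm
  refine card_bij (fun a _ => e a) ?_ (fun a _ b _ h => he h) ?_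
  · intro a ha
    simpa [he.extend_apply] using ha
  · intro b hb
    rw [mem_filter] at hb
    by_cases h : ∃ a, e a = b
    · obtain ⟨a, rfl⟩ := h
      exact ⟨a, by simpa [he.extend_apply] using hb.2, rfl⟩
    · simp [Function.extend_apply' _ _ _ h] at hb

theorem isCircuitCode_of_periodic {ι : Type*} [Fintype ι] {d k N : ℕ} (hk : 1 ≤ k) (hN : 3 ≤ N)
    (hd : Fintype.card ι ≤ d) {x : ℕ → ι → Bool} (hx : Function.Periodic x N)
    (hstep : ∀ t, hammingDist (x t) (x (t + 1)) = 1)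
    (hdist : ∀ t δ, 2 * δ ≤ N → min δ k ≤ hammingDist (x t) (x (t + δ))) :
    ∃ y : ZMod N → (Fin d → Bool), IsCircuitCode d k N y := by
  obtain ⟨e⟩ : Nonempty (ι ↪ Fin d) :=
    Function.Embedding.nonempty_of_card_le (by simpa using hd)
  have : NeZero N := ⟨by omega⟩
  have : Fact (1 < N) := ⟨by omega⟩
  have hadd (i j : ZMod N) : x (i + j).val = x (i.val + j.val) := by
    rw [ZMod.val_add, hx.map_mod_nat]
  have hmain (i j : ZMod N) : min (cycDist i j) k ≤ hammingDist (x i.val) (x j.val) := by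
    by_cases hij : i = j
    · subst hij
      simp [cycDist]
    have hsum : (j - i).val + (i - j).val = N := by
      have : NeZero (j - i) := ⟨sub_ne_zero.2 (Ne.symm hij)⟩
      rw [← neg_sub j i, ZMod.val_neg_of_ne_zero]
      have := ZMod.val_lt (j - i)
      omega
    by_cases h : 2 * (j - i).val ≤ N
    · have h1 := hdist i.val (j - i).val h
      rw [← hadd, add_sub_cancel] at h1
      exact le_trans (min_le_min_right _ (min_le_left _ _)) h1
    · have h1 := hdist j.val (i - j).val (by omega)
      rw [← hadd, add_sub_cancel, hammingDist_comm] at h1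
      exact le_trans (min_le_min_right _ (min_le_right _ _)) h1
  refine ⟨fun i => Function.extend e (x i.val) fun _ => false, hN, ?_, ?_, ?_⟩
  · intro i j hij
    by_contra hne
    have h1 := hmain i j
    rw [← hammingDist_extend e.injective (x i.val) (x j.val) fun _ => false] at h1
    simp only at hij
    rw [hij, hammingDist_self] at h1
    have h2 : 0 < (j - i).val := ZMod.val_pos.2 (sub_ne_zero.2 (Ne.symm hne))
    have h3 : 0 < (i - j).val := ZMod.val_pos.2 (sub_ne_zero.2 hne)
    rw [cycDist] at h1
    omega
  · intro i
    simp only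
    rw [hammingDist_extend e.injective, hadd, ZMod.val_one, hstep]
  · intro i j
    simp only
    rw [hammingDist_extend e.injective]
    exact hmain i j

/-! ### Bounds on `K` -/

theorem IsCircuitCode.length_le {d k N : ℕ} {x : ZMod N → (Fin d → Bool)}
    (h : IsCircuitCode d k N x) : N ≤ 2 ^ d := by
  have : NeZero N := ⟨by have := h.1; omega⟩
  have := Fintype.card_le_of_injective x h.2.1
  simpa [ZMod.card] using this

theorem K_le_two_pow (d k : ℕ) : K d k ≤ 2 ^ d := by
  refine csSup_le' ?_
  rintro N ⟨x, hx⟩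
  exact hx.length_le

theorem le_K {d k N : ℕ} {x : ZMod N → (Fin d → Bool)} (h : IsCircuitCode d k N x) :
    N ≤ K d k :=
  le_csSup ⟨2 ^ d, by rintro N ⟨x, hx⟩; exact hx.length_le⟩ ⟨x, h⟩

theorem two_pow_le_K {n t d k : ℕ} (hk : 1 ≤ k) (hn : 2 ≤ n) (ht : t ≠ 0) (hnt : n ≤ 2 ^ t)
    (hd : n + 2 * ((k + 2) * ((k + 1) * t)) ≤ d) : 2 ^ n ≤ K d k := by
  obtain ⟨p, hp⟩ := exists_separating_map n t (k + 1) ht hnt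
  obtain ⟨g, hg⟩ := exists_isCyclicGrayCode n (by omega)
  have h4 : 2 ^ 2 ≤ 2 ^ n := Nat.pow_le_pow_right (by omega) hn
  have hN : 2 ^ n ≤ 2 ^ n * ((k + 2) * ((k + 1) * t) + 1) :=
    Nat.le_mul_of_pos_right _ (by omega)
  obtain ⟨y, hy⟩ := isCircuitCode_of_periodic (d := d) (x := syndromeWalk (k + 2) g p) hk
    (le_trans (by omega) hN)
    (by simp only [Fintype.card_sum, Fintype.card_prod, Fintype.card_fin]; omega)
    (syndromeWalk_periodic (k + 2) (by omega) hg p)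
    (fun r => hammingDist_syndromeWalk_of_le (k + 2) hg p r 1 (by omega))
    (fun r δ h => by
      by_cases h1 : δ ≤ (k + 2) * ((k + 1) * t) + 1
      · rw [hammingDist_syndromeWalk_of_le (k + 2) hg p r δ h1]
        exact min_le_left _ _
      · exact (min_le_right _ _).trans
          (le_hammingDist_syndromeWalk (by omega) hg hp r δ (by omega) h))
  exact hN.trans (le_K hy)

open Filter Topology in
theorem tendsto_two_pow_sub_div_two_pow_add (a b c : ℝ) :
    Tendsto (fun i : ℕ => ((2 : ℝ) ^ i - a * i) / (2 ^ i + b * i + c)) atTop (𝓝 1) := by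
  have h1 : Tendsto (fun i : ℕ => (i : ℝ) / 2 ^ i) atTop (𝓝 0) := by
    simpa using tendsto_pow_const_div_const_pow_of_one_lt 1 (one_lt_two (α := ℝ))
  have h2 : Tendsto (fun i : ℕ => ((2 : ℝ) ^ i)⁻¹) atTop (𝓝 0) :=
    (tendsto_pow_atTop_atTop_of_one_lt one_lt_two).inv_tendsto_atTop
  have h3 : Tendsto (fun i : ℕ => (1 - a * ((i : ℝ) / 2 ^ i)) /
      (1 + b * ((i : ℝ) / 2 ^ i) + c * ((2 : ℝ) ^ i)⁻¹)) atTop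
      (𝓝 ((1 - a * 0) / (1 + b * 0 + c * 0))) :=
    (tendsto_const_nhds.sub (h1.const_mul a)).div
      ((tendsto_const_nhds.add (h1.const_mul b)).add (h2.const_mul c)) (by simp)
  simp only [mul_zero, sub_zero, add_zero, div_one] at h3
  refine h3.congr fun i => ?_
  have h4 : (2 : ℝ) ^ i ≠ 0 := by positivity
  rw [← mul_div_mul_left _ _ h4]
  congr 1 <;> field_simp

/-- For every `k ≥ 1`, along the subsequence `d_i = 2^i + 2i + 5k − 4` one has
`lim_{i→∞} (log₂ K(d_i,k))/d_i = 1`. -/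
theorem stmt_9 (k : ℕ) (hk : 1 ≤ k) :
    Filter.Tendsto
      (fun i : ℕ => Real.logb 2 (K (2 ^ i + 2 * i + 5 * k - 4) k) /
        (2 ^ i + 2 * i + 5 * k - 4 : ℕ))
      Filter.atTop (nhds 1) := by
  have hlow := tendsto_two_pow_sub_div_two_pow_add ((2 * ((k + 2) * (k + 1)) : ℕ) : ℝ) 2
    (5 * k - 4)
  have hev : ∀ᶠ i : ℕ in Filter.atTop, i ≠ 0 ∧ 2 + 2 * ((k + 2) * (k + 1)) * i ≤ 2 ^ i := by
    have h1 : Filter.Tendsto (fun i : ℕ => ((i : ℝ) ^ 1) / 2 ^ i) Filter.atTop (nhds 0) :=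
      tendsto_pow_const_div_const_pow_of_one_lt 1 one_lt_two
    have hpos : (0 : ℝ) < 1 / (2 + 2 * ((k + 2) * (k + 1))) := by positivity
    filter_upwards [h1.eventually_lt_const hpos, Filter.eventually_ge_atTop 1] with i hi hi1
    refine ⟨by omega, ?_⟩
    rw [div_lt_div_iff₀ (by positivity) (by positivity), pow_one, one_mul] at hi
    have h2 : i * (2 + 2 * ((k + 2) * (k + 1))) ≤ 2 ^ i := by exact_mod_cast hi.le
    nlinarith
  have hden (i : ℕ) : ((2 ^ i + 2 * i + 5 * k - 4 : ℕ) : ℝ) = 2 ^ i + 2 * i + (5 * k - 4) := by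
    have h1 : 0 < 2 ^ i := by positivity
    rw [Nat.cast_sub (by omega)]
    push_cast
    ring
  refine tendsto_of_tendsto_of_tendsto_of_le_of_le' hlow tendsto_const_nhds ?_ ?_
  · filter_upwards [hev] with i hi
    have hK : 2 ^ (2 ^ i - 2 * ((k + 2) * (k + 1)) * i) ≤ K (2 ^ i + 2 * i + 5 * k - 4) k := by
      refine two_pow_le_K hk (by omega) hi.1 (by omega) ?_
      rw [show 2 * ((k + 2) * ((k + 1) * i)) = 2 * ((k + 2) * (k + 1)) * i by ring]
      omega
    rw [← hden]
    refine div_le_div_of_nonneg_right ?_ (Nat.cast_nonneg _)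
    have h0 : (0 : ℝ) < K (2 ^ i + 2 * i + 5 * k - 4) k := by
      exact_mod_cast lt_of_lt_of_le (by positivity) hK
    rw [Real.le_logb_iff_rpow_le one_lt_two h0]
    have h1 : (2 : ℝ) ^ i - ((2 * ((k + 2) * (k + 1)) : ℕ) : ℝ) * i =
        ((2 ^ i - 2 * ((k + 2) * (k + 1)) * i : ℕ) : ℝ) := by
      rw [Nat.cast_sub (by omega)]
      push_cast
      ring
    rw [h1, Real.rpow_natCast]
    exact_mod_cast hK
  · refine Filter.Eventually.of_forall fun i => ?_
    refine div_le_one_of_le₀ ?_ (Nat.cast_nonneg _)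
    rcases Nat.eq_zero_or_pos (K (2 ^ i + 2 * i + 5 * k - 4) k) with h | h
    · rw [h]
      simp
    · rw [Real.logb_le_iff_le_rpow one_lt_two (by exact_mod_cast h), Real.rpow_natCast]
      exact_mod_cast K_le_two_pow _ _
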